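/- Let n be an even positive integer, J the 2×2 matrix [[0,1],[-1,0]], and a_J = diag(J,…,J) ∈ GL_n(ℂ) the block-diagonal matrix with n/2 blocks J. Then there exist no invertible matrix g ∈ GL_n(ℂ) and no nonzero scalar λ ∈ ℂ* such that a_J = λ · g · (ḡ)⁻¹, where ḡ denotes the entrywise complex conjugate of g. (Equivalently, the class of π(a_J) in H¹(PGL_n(ℂ), σ) is nontrivial.) -/

import Mathlib

open Matrix

noncomputable section

/-- Entrywise complex conjugation as a ring automorphism of `n × n` complex matrices. -/
def conjMat (n : ℕ) : Matrix (Fin n) (Fin n) ℂ ≃+* Matrix (Fin n) (Fin n) ℂ :=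
  (starRingAut : ℂ ≃+* ℂ).mapMatrix

/-- Entrywise complex conjugation `g ↦ ḡ` as an automorphism of `GL n ℂ`. -/
def conjGL (n : ℕ) : GL (Fin n) ℂ ≃* GL (Fin n) ℂ :=
  Units.mapEquiv (conjMat n).toMulEquiv

/-- The matrix `J = [[0,1],[-1,0]]`. -/
def Jmat : Matrix (Fin 2) (Fin 2) ℂ := !![0, 1; -1, 0]

/-- The interleaving bijection `Fin 2 × Fin n' ≃ Fin (2 * n')`, `(p, b) ↦ p + 2 * b`. -/
def interleave (n' : ℕ) : Fin 2 × Fin n' ≃ Fin (2 * n') :=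
  (Equiv.prodComm _ _).trans (finProdFinEquiv.trans (finCongr (Nat.mul_comm n' 2)))

/-- The block-diagonal matrix `a_J = diag(J, …, J)` with `n'` diagonal blocks `J`:
its `(p + 2b, q + 2c)` entry is `J p q` if `b = c` and `0` otherwise. -/
def aJ (n' : ℕ) : Matrix (Fin (2 * n')) (Fin (2 * n')) ℂ :=
  (Matrix.blockDiagonal fun _ : Fin n' => Jmat).submatrix
    (interleave n').symm (interleave n').symm

theorem Jmat_mul_self : Jmat * Jmat = -1 := by
  ext i j
  fin_cases i <;> fin_cases j <;> simp [Jmat]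

theorem aJ_mul_self (n' : ℕ) : aJ n' * aJ n' = -1 := by
  rw [aJ, Matrix.submatrix_mul_equiv, ← Matrix.blockDiagonal_mul, Jmat_mul_self]
  have h : (Matrix.blockDiagonal fun _ : Fin n' => (-1 : Matrix (Fin 2) (Fin 2) ℂ)) = -1 := by
    rw [← Matrix.blockDiagonal_one, ← Matrix.blockDiagonal_neg]
    rfl
  rw [h, Matrix.submatrix_neg, Pi.neg_apply, Pi.neg_apply, Matrix.submatrix_one_equiv]

theorem conjMat_apply (n : ℕ) (M : Matrix (Fin n) (Fin n) ℂ) (i j : Fin n) :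
    conjMat n M i j = star (M i j) := rfl

theorem conjMat_smul (n : ℕ) (c : ℂ) (M : Matrix (Fin n) (Fin n) ℂ) :
    conjMat n (c • M) = star c • conjMat n M := by
  ext i j
  simp [conjMat_apply]

theorem conjMat_coe (n : ℕ) (g : GL (Fin n) ℂ) :
    conjMat n (g : Matrix (Fin n) (Fin n) ℂ) = (conjGL n g : GL (Fin n) ℂ) := rfl

theorem conjGL_conjGL (n : ℕ) (g : GL (Fin n) ℂ) : conjGL n (conjGL n g) = g := by
  ext i j
  simp [← conjMat_coe, conjMat_apply]

theorem conjMat_aJ (n' : ℕ) : conjMat (2 * n') (aJ n') = aJ n' := by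
  have hJ (p q : Fin 2) : star (Jmat p q) = Jmat p q := by
    fin_cases p <;> fin_cases q <;> simp [Jmat]
  ext i j
  rw [conjMat_apply, aJ, Matrix.submatrix_apply, Matrix.blockDiagonal_apply]
  split_ifs
  · exact hJ _ _
  · exact star_zero _

/-- A scalar multiple `M = c g ḡ⁻¹` of a coboundary satisfies `M M̄ = |c|²`. -/
theorem smul_coboundary_mul_conjMat (n : ℕ) (g : GL (Fin n) ℂ) (c : ℂ)
    (M : Matrix (Fin n) (Fin n) ℂ)
    (hM : M = c • ((g : Matrix (Fin n) (Fin n) ℂ) *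
      (((conjGL n g)⁻¹ : GL (Fin n) ℂ) : Matrix (Fin n) (Fin n) ℂ))) :
    M * conjMat n M = (Complex.normSq c : ℂ) • 1 := by
  rw [hM, ← Units.val_mul, conjMat_smul, conjMat_coe, map_mul, map_inv, conjGL_conjGL,
    smul_mul_smul_comm, ← Units.val_mul]
  rw [show g * (conjGL n g)⁻¹ * (conjGL n g * g⁻¹) = 1 by group, Units.val_one,
    Complex.star_def, Complex.mul_conj]

/-- for even positive `n = 2n'`, there are no `g ∈ GL_n(ℂ)` and `λ ∈ ℂ*` with
`a_J = λ · g · (ḡ)⁻¹`; equivalently, the class of `π(a_J)` in `H¹(PGL_n(ℂ), σ)` is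
nontrivial. -/
theorem aJ_class_nontrivial (n' : ℕ) (hn' : 0 < n') :
    ¬ ∃ (g : GL (Fin (2 * n')) ℂ) (lam : ℂ), lam ≠ 0 ∧
      aJ n' = lam • ((g : Matrix (Fin (2 * n')) (Fin (2 * n')) ℂ) *
        (((conjGL (2 * n') g)⁻¹ : GL (Fin (2 * n')) ℂ) :
          Matrix (Fin (2 * n')) (Fin (2 * n')) ℂ)) := by
  rintro ⟨g, lam, -, h⟩
  have hsq := smul_coboundary_mul_conjMat _ g lam _ h
  rw [conjMat_aJ, aJ_mul_self] at hsq
  have hentry := congrArg Complex.re (congrFun₂ hsq ⟨0, by omega⟩ ⟨0, by omega⟩)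
  simp at hentry
  linarith [Complex.normSq_nonneg lam]


end
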